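/- Let I ⊆ (0,∞) be an interval and let f : I → (0,∞) satisfy f(x·y / (t·x + (1−t)·y)) ≤ (1−t)·f(x) + t·f(y) for all x,y ∈ I and t ∈ [0,1]. Then for all x, y, z ∈ I: (2/3)·(f(2xz/(x+z)) + f(2yz/(y+z)) + f(2xy/(x+y))) ≤ f(3xyz/(xy + yz + xz)) + (f(x) + f(y) + f(z))/3. -/

import Mathlib

/-- If `a` and `b` lie on the same side of the mean of `a`, `b`, `c`, then `(a + c) / 2` and
`(b + c) / 2` lie between that mean and `c`, with explicit weights. -/
lemma exists_weight_of_same_side {a b c m : ℝ} (hm : a + b + c = 3 * m)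
    (h : 0 ≤ (m - a) * (m - b)) :
    ∃ w : ℝ, 0 ≤ w ∧ w ≤ 1 / 2 ∧ (a + c) / 2 = (1 - w) * m + w * c ∧
      (b + c) / 2 = (1 / 2 + w) * m + (1 / 2 - w) * c := by
  by_cases h0 : (m - a) + (m - b) = 0
  · have hb : m - b = 0 := by nlinarith [sq_nonneg (m - b)]
    exact ⟨0, le_rfl, by norm_num, by linarith, by linarith⟩
  · have hs : 0 < ((m - a) + (m - b)) ^ 2 := by positivity
    have hw : (m - b) / (2 * ((m - a) + (m - b))) * ((m - a) + (m - b)) = (m - b) / 2 := by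
      field_simp
    generalize (m - b) / (2 * ((m - a) + (m - b))) = w at hw
    have hc : c = m + ((m - a) + (m - b)) := by linarith
    refine ⟨w, ?_, ?_, ?_, ?_⟩
    · by_contra! hneg
      have h1 : w * ((m - a) + (m - b)) ^ 2 = (m - b) / 2 * ((m - a) + (m - b)) := by
        rw [← hw]; ring
      nlinarith [sq_nonneg (m - b)]
    · by_contra! hgt
      have h1 : w * ((m - a) + (m - b)) ^ 2 = (m - b) / 2 * ((m - a) + (m - b)) := by
        rw [← hw]; ring
      nlinarith [sq_nonneg (m - a)]
    · rw [hc]; linarith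
    · rw [hc]; linarith

/-- **Popoviciu's inequality** when `a` and `b` lie on the same side of the mean. -/
lemma ConvexOn.popoviciu_of_same_side {s : Set ℝ} {g : ℝ → ℝ} (hg : ConvexOn ℝ s g)
    {a b c m : ℝ} (ha : a ∈ s) (hb : b ∈ s) (hc : c ∈ s) (hms : m ∈ s)
    (hm : a + b + c = 3 * m) (h : 0 ≤ (m - a) * (m - b)) :
    2 * (g ((a + b) / 2) + g ((b + c) / 2) + g ((a + c) / 2)) ≤
      3 * g m + (g a + g b + g c) := by
  obtain ⟨w, hw0, hw1, hac, hbc⟩ := exists_weight_of_same_side hm h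
  have h1 := hg.2 hms hc (by linarith : 0 ≤ 1 - w) hw0 (by ring)
  have h2 := hg.2 hms hc (by linarith : 0 ≤ 1 / 2 + w) (by linarith : 0 ≤ 1 / 2 - w) (by ring)
  have h3 := hg.2 ha hb (by norm_num : (0 : ℝ) ≤ 1 / 2) (by norm_num : (0 : ℝ) ≤ 1 / 2)
    (by norm_num)
  simp only [smul_eq_mul] at h1 h2 h3
  rw [← hac] at h1
  rw [← hbc] at h2
  rw [show 1 / 2 * a + 1 / 2 * b = (a + b) / 2 by ring] at h3
  linarith

/-- **Popoviciu's inequality** for convex functions of a real variable. -/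
lemma ConvexOn.popoviciu {s : Set ℝ} {g : ℝ → ℝ} (hg : ConvexOn ℝ s g) {a b c : ℝ}
    (ha : a ∈ s) (hb : b ∈ s) (hc : c ∈ s) :
    2 * (g ((a + b) / 2) + g ((b + c) / 2) + g ((a + c) / 2)) ≤
      3 * g ((a + b + c) / 3) + (g a + g b + g c) := by
  have hms : (a + b + c) / 3 ∈ s := by
    have h1 := hg.1 ha hb (by norm_num : (0 : ℝ) ≤ 1 / 2) (by norm_num : (0 : ℝ) ≤ 1 / 2)
      (by norm_num)
    have h2 := hg.1 h1 hc (by norm_num : (0 : ℝ) ≤ 2 / 3) (by norm_num : (0 : ℝ) ≤ 1 / 3)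
      (by norm_num)
    simp only [smul_eq_mul] at h2
    convert h2 using 1
    ring
  generalize hm : (a + b + c) / 3 = m at hms ⊢
  have habc : a + b + c = 3 * m := by linarith
  by_cases hab : 0 ≤ (m - a) * (m - b)
  · exact hg.popoviciu_of_same_side ha hb hc hms habc hab
  by_cases hbc : 0 ≤ (m - b) * (m - c)
  · have := hg.popoviciu_of_same_side hb hc ha hms (by linarith) hbc
    rw [add_comm c a, add_comm b a] at this
    linarith
  · have hac : 0 ≤ (m - a) * (m - c) := by
      by_contra! hac
      push Not at hab hbc
      nlinarith [mul_pos_of_neg_of_neg hab hbc, sq_nonneg (m - b)]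
    have := hg.popoviciu_of_same_side ha hc hb hms (by linarith) hac
    rw [add_comm c b] at this
    linarith

/-- The reciprocal of a convex combination of reciprocals. -/
lemma weighted_harmonic_mean_eq {u v p q : ℝ} (hu : 0 < u) (hv : 0 < v) (hp : 0 ≤ p)
    (hq : 0 ≤ q) (hpq : p + q = 1) :
    u⁻¹ * v⁻¹ / (q * u⁻¹ + (1 - q) * v⁻¹) = (p * u + q * v)⁻¹ := by
  obtain rfl : p = 1 - q := by linarith
  have h : 0 < (1 - q) * u + q * v := by
    rcases hq.eq_or_lt with rfl | hq
    · simpa using hu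
    · positivity
  have h' : q * u⁻¹ + (1 - q) * v⁻¹ = ((1 - q) * u + q * v) * (u⁻¹ * v⁻¹) := by
    field_simp
    ring
  rw [h']
  field_simp

/-- The weighted harmonic mean of two positive points of an interval lies in the interval. -/
lemma inv_convex_comb_mem {I : Set ℝ} (hI : Convex ℝ I) {u v p q : ℝ} (hu : 0 < u) (hv : 0 < v)
    (huI : u⁻¹ ∈ I) (hvI : v⁻¹ ∈ I) (hp : 0 ≤ p) (hq : 0 ≤ q) (hpq : p + q = 1) :
    (p * u + q * v)⁻¹ ∈ I := by
  wlog huv : u ≤ v generalizing u v p q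
  · rw [add_comm]
    exact this hv hu hvI huI hq hp (by linarith) (by linarith)
  refine hI.ordConnected.out hvI huI ⟨?_, ?_⟩
  · have : u ≤ p * u + q * v := by nlinarith
    exact inv_anti₀ (by linarith) (by nlinarith)
  · exact inv_anti₀ hu (by nlinarith)

/-- If `f` is harmonically convex on an interval of positive numbers, then
`u ↦ f u⁻¹` is convex. -/
lemma convexOn_comp_inv {I : Set ℝ} (hI : Convex ℝ I) {f : ℝ → ℝ}
    (hf : ∀ x ∈ I, ∀ y ∈ I, ∀ t ∈ Set.Icc (0 : ℝ) 1,
      f (x * y / (t * x + (1 - t) * y)) ≤ (1 - t) * f x + t * f y) :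
    ConvexOn ℝ {u : ℝ | 0 < u ∧ u⁻¹ ∈ I} (fun u => f u⁻¹) := by
  constructor
  · rintro u ⟨hu, huI⟩ v ⟨hv, hvI⟩ p q hp hq hpq
    exact ⟨convex_Ioi (0 : ℝ) hu hv hp hq hpq, inv_convex_comb_mem hI hu hv huI hvI hp hq hpq⟩
  · rintro u ⟨hu, huI⟩ v ⟨hv, hvI⟩ p q hp hq hpq
    have h := hf _ huI _ hvI q ⟨hq, by linarith⟩
    rw [weighted_harmonic_mean_eq hu hv hp hq hpq, show 1 - q = p by linarith] at h
    exact h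

/-- Popoviciu-type inequality for `H_tA_t`-convex functions. -/
theorem popoviciu_HA (I : Set ℝ) (hI : Convex ℝ I) (hI_pos : I ⊆ Set.Ioi (0 : ℝ))
    (f : ℝ → ℝ) (hf_pos : ∀ x ∈ I, 0 < f x)
    (hf : ∀ x ∈ I, ∀ y ∈ I, ∀ t ∈ Set.Icc (0 : ℝ) 1,
      f (x * y / (t * x + (1 - t) * y)) ≤ (1 - t) * f x + t * f y) :
    ∀ x ∈ I, ∀ y ∈ I, ∀ z ∈ I,
      (2 / 3) * (f (2 * x * z / (x + z)) + f (2 * y * z / (y + z)) +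
          f (2 * x * y / (x + y))) ≤
        f (3 * x * y * z / (x * y + y * z + x * z)) + (f x + f y + f z) / 3 := by
  intro x hx y hy z hz
  have mem {w : ℝ} (hw : w ∈ I) : w⁻¹ ∈ {u : ℝ | 0 < u ∧ u⁻¹ ∈ I} :=
    ⟨inv_pos.2 (hI_pos hw), by simpa using hw⟩
  have h := (convexOn_comp_inv hI hf).popoviciu (mem hx) (mem hy) (mem hz)
  have harm {v w : ℝ} (hv : v ∈ I) (hw : w ∈ I) :
      ((v⁻¹ + w⁻¹) / 2)⁻¹ = 2 * v * w / (v + w) := by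
    have hv' : 0 < v := hI_pos hv
    have hw' : 0 < w := hI_pos hw
    field_simp
    ring
  have harm₃ : ((x⁻¹ + y⁻¹ + z⁻¹) / 3)⁻¹ = 3 * x * y * z / (x * y + y * z + x * z) := by
    have hx' : 0 < x := hI_pos hx
    have hy' : 0 < y := hI_pos hy
    have hz' : 0 < z := hI_pos hz
    have h₁ : (x⁻¹ + y⁻¹ + z⁻¹) / 3 = (x * y + y * z + x * z) / (3 * x * y * z) := by
      field_simp
      ring
    rw [h₁, inv_div]
  simp only [harm hx hy, harm hy hz, harm hx hz, harm₃, inv_inv] at h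
  linarith
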